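/- (Vertex splitting preserves terminal minimum cuts.) Let G be a k-terminal weighted graph, let v be a vertex with neighbors u₁,…,u_d (d ≥ 1), and let C be the sum of the capacities of all edges of G. Let G' be obtained from G by deleting v, adding new vertices v₁,…,v_d, adding edges {v_i, v_{i+1}} of capacity C+1 for i = 1,…,d−1, and adding edges {u_i, v_i} of capacity c(u_i, v) for i = 1,…,d; the terminal set of G' is (K∖{v}) ∪ {v₁} if v ∈ K and K otherwise. Then for every S ⊆ K, mincut_{G'}(S') = mincut_G(S), where S' is obtained from S by replacing v with v₁ if v ∈ S. -/

import Mathlib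

/-- A `k`-terminal weighted graph: a finite simple undirected graph with nonnegative
edge capacities `c` (with `c u v = 0` whenever `{u,v}` is not an edge). -/
structure WGraph (V : Type*) where
  verts : Finset V
  Adj : V → V → Prop
  symm : ∀ u v, Adj u v → Adj v u
  irrefl : ∀ v, ¬Adj v v
  adj_mem : ∀ u v, Adj u v → u ∈ verts ∧ v ∈ verts
  c : V → V → ℝ
  c_symm : ∀ u v, c u v = c v u
  c_nonneg : ∀ u v, 0 ≤ c u v
  c_support : ∀ u v, ¬Adj u v → c u v = 0

/-- The cost of the cut `(U, verts \ U)`: the sum of the capacities of the edges with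
exactly one endpoint in `U`. -/
noncomputable def cutCost {V : Type*} [DecidableEq V] (G : WGraph V) (U : Finset V) : ℝ :=
  ∑ u ∈ U, ∑ v ∈ G.verts \ U, G.c u v

/-- `mincut G K S` is the minimum cost of an `S`-separating cut, i.e. of a vertex set
`U ⊆ verts` with `U ∩ K = S`. -/
noncomputable def mincut {V : Type*} [DecidableEq V] (G : WGraph V) (K S : Finset V) : ℝ :=
  sInf {x | ∃ U : Finset V, U ⊆ G.verts ∧ U ∩ K = S ∧ x = cutCost G U}

lemma cutCost_eq_ite {V : Type*} [DecidableEq V] (G : WGraph V) (U : Finset V)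
    (hU : U ⊆ G.verts) :
    cutCost G U = ∑ a ∈ G.verts, ∑ b ∈ G.verts, if a ∈ U ∧ b ∉ U then G.c a b else 0 := by
  unfold cutCost
  rw [← Finset.sum_subset hU]
  · refine Finset.sum_congr rfl fun a ha => ?_
    rw [Finset.sdiff_eq_filter, Finset.sum_filter]
    simp [ha]
  · intro a _ ha
    simp [ha]

lemma cutCost_nonneg {V : Type*} [DecidableEq V] (G : WGraph V) (U : Finset V) :
    0 ≤ cutCost G U :=
  Finset.sum_nonneg fun a _ => Finset.sum_nonneg fun b _ => G.c_nonneg a b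

lemma cutCost_le_half {V : Type*} [DecidableEq V] (G : WGraph V) (U : Finset V)
    (hU : U ⊆ G.verts) :
    cutCost G U ≤ (∑ a ∈ G.verts, ∑ b ∈ G.verts, G.c a b) / 2 := by
  have h1 := cutCost_eq_ite G U hU
  have h2 : cutCost G U =
      ∑ a ∈ G.verts, ∑ b ∈ G.verts, if b ∈ U ∧ a ∉ U then G.c a b else 0 := by
    rw [h1, Finset.sum_comm]
    refine Finset.sum_congr rfl fun a _ => Finset.sum_congr rfl fun b _ => ?_
    rw [G.c_symm]
  have h3 : cutCost G U + cutCost G U ≤ ∑ a ∈ G.verts, ∑ b ∈ G.verts, G.c a b := by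
    nth_rewrite 1 [h1]
    rw [h2, ← Finset.sum_add_distrib]
    refine Finset.sum_le_sum fun a _ => ?_
    rw [← Finset.sum_add_distrib]
    refine Finset.sum_le_sum fun b _ => ?_
    have := G.c_nonneg a b
    by_cases ha : a ∈ U <;> by_cases hb : b ∈ U <;> simp [ha, hb, this]
  linarith

lemma le_cutCost {V : Type*} [DecidableEq V] (G : WGraph V) (U : Finset V) (a b : V)
    (ha : a ∈ U) (hb : b ∈ G.verts) (hb' : b ∉ U) : G.c a b ≤ cutCost G U := by
  unfold cutCost
  calc G.c a b ≤ ∑ w ∈ G.verts \ U, G.c a w :=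
        Finset.single_le_sum (f := fun w => G.c a w) (fun w _ => G.c_nonneg a w)
          (Finset.mem_sdiff.2 ⟨hb, hb'⟩)
    _ ≤ _ := Finset.single_le_sum (f := fun u => ∑ w ∈ G.verts \ U, G.c u w)
          (fun u _ => Finset.sum_nonneg fun w _ => G.c_nonneg u w) ha

/-- If the two cuts agree away from `v` and the new vertices all lie on the side of `v`,
the costs agree. -/
lemma cutCost_split {V : Type*} [DecidableEq V]
    (G G' : WGraph V) (v : V) (hv : v ∈ G.verts) (d : ℕ)
    (nv : Fin d → V) (hnv_inj : Function.Injective nv)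
    (hnv_fresh : ∀ i, nv i ∉ G.verts)
    (hverts : G'.verts = G.verts.erase v ∪ Finset.image nv Finset.univ)
    (hold : ∀ a ∈ G.verts.erase v, ∀ b ∈ G.verts.erase v, G'.c a b = G.c a b)
    (hstar : ∀ a ∈ G.verts.erase v, ∑ i, G'.c a (nv i) = G.c a v)
    (U U' : Finset V) (hU : U ⊆ G.verts) (hU' : U' ⊆ G'.verts)
    (h1 : ∀ a ∈ G.verts.erase v, (a ∈ U' ↔ a ∈ U)) (h2 : ∀ i, nv i ∈ U' ↔ v ∈ U) :
    cutCost G' U' = cutCost G U := by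
  rw [cutCost_eq_ite G U hU, cutCost_eq_ite G' U' hU']
  have hdisj : Disjoint (G.verts.erase v) (Finset.image nv Finset.univ) := by
    rw [Finset.disjoint_left]
    intro a ha hb
    obtain ⟨i, _, rfl⟩ := Finset.mem_image.1 hb
    exact hnv_fresh i (Finset.mem_of_mem_erase ha)
  have hstar' : ∀ a ∈ G.verts.erase v, ∑ i, G'.c (nv i) a = G.c v a := by
    intro a ha
    rw [G.c_symm, ← hstar a ha]
    exact Finset.sum_congr rfl fun i _ => G'.c_symm _ _
  conv_rhs => rw [← Finset.insert_erase hv]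
  simp only [hverts, Finset.sum_union hdisj, Finset.sum_image hnv_inj.injOn,
    Finset.sum_insert (Finset.notMem_erase v G.verts), Finset.sum_add_distrib, h2]
  have e1 : ∑ a ∈ G.verts.erase v, ∑ b ∈ G.verts.erase v,
      (if a ∈ U' ∧ b ∉ U' then G'.c a b else 0) = ∑ a ∈ G.verts.erase v,
      ∑ b ∈ G.verts.erase v, (if a ∈ U ∧ b ∉ U then G.c a b else 0) := by
    refine Finset.sum_congr rfl fun a ha => Finset.sum_congr rfl fun b hb => ?_
    simp only [h1 a ha, h1 b hb, hold a ha b hb]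
  have e2 : ∑ a ∈ G.verts.erase v, ∑ i, (if a ∈ U' ∧ v ∉ U then G'.c a (nv i) else 0) =
      ∑ a ∈ G.verts.erase v, (if a ∈ U ∧ v ∉ U then G.c a v else 0) := by
    refine Finset.sum_congr rfl fun a ha => ?_
    simp only [h1 a ha, ← hstar a ha]
    split_ifs <;> simp
  have e3 : ∑ i, ∑ a ∈ G.verts.erase v, (if v ∈ U ∧ a ∉ U' then G'.c (nv i) a else 0) =
      ∑ a ∈ G.verts.erase v, (if v ∈ U ∧ a ∉ U then G.c v a else 0) := by
    rw [Finset.sum_comm]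
    refine Finset.sum_congr rfl fun a ha => ?_
    simp only [h1 a ha, ← hstar' a ha]
    split_ifs <;> simp
  rw [e1, e2, e3]
  simp only [and_not_self, if_false, Finset.sum_const_zero]
  ring

lemma fin_step {d : ℕ} (hd : 0 < d) (P : Fin d → Prop)
    (h : ∀ i j : Fin d, (i : ℕ) + 1 = j → (P i ↔ P j)) : ∀ i, P i ↔ P ⟨0, hd⟩ := by
  rintro ⟨n, hn⟩
  induction n with
  | zero => rfl
  | succ n ih => rw [← ih (by omega)]; exact (h ⟨n, by omega⟩ ⟨n+1, hn⟩ rfl).symm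


/-- Vertex splitting preserves terminal minimum cuts: let `v` be a vertex of `G` whose
neighbours are enumerated by `ns : Fin d → V` (`d ≥ 1`), and let `C` be the sum of the
capacities of all edges of `G`.  Let `G'` be obtained from `G` by deleting `v`, adding
fresh vertices `nv 0, …, nv (d−1)`, adding edges `{nv i, nv (i+1)}` of capacity `C+1`,
and adding edges `{ns i, nv i}` of capacity `c (ns i) v`.  The terminal set of `G'` is
obtained from `K` by replacing `v` with `nv 0` if `v ∈ K`.  Then for every `S ⊆ K`,
`mincut G' K' S' = mincut G K S`, where `S'` is obtained from `S` by replacing `v`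
with `nv 0` if `v ∈ S`. -/
theorem vertex_splitting_preserves_mincuts {V : Type*} [DecidableEq V]
    (G G' : WGraph V) (K : Finset V) (hK : K ⊆ G.verts)
    (v : V) (hv : v ∈ G.verts) (d : ℕ) (hd : 0 < d)
    (ns : Fin d → V) (hns_inj : Function.Injective ns)
    (hns : ∀ w, G.Adj v w ↔ ∃ i, ns i = w)
    (nv : Fin d → V) (hnv_inj : Function.Injective nv)
    (hnv_fresh : ∀ i, nv i ∉ G.verts)
    (C : ℝ) (hC : C = (∑ a ∈ G.verts, ∑ b ∈ G.verts, G.c a b) / 2)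
    (hverts : G'.verts = G.verts.erase v ∪ Finset.image nv Finset.univ)
    (hAdj : ∀ a b, G'.Adj a b ↔
      ((G.Adj a b ∧ a ≠ v ∧ b ≠ v) ∨
       (∃ i j : Fin d, (i : ℕ) + 1 = (j : ℕ) ∧ ({a, b} : Set V) = {nv i, nv j}) ∨
       (∃ i : Fin d, ({a, b} : Set V) = {ns i, nv i})))
    (hc_path : ∀ i j : Fin d, (i : ℕ) + 1 = (j : ℕ) → G'.c (nv i) (nv j) = C + 1)
    (hc_star : ∀ i : Fin d, G'.c (ns i) (nv i) = G.c (ns i) v)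
    (hc_old : ∀ a b, a ≠ v → b ≠ v → (∀ i, a ≠ nv i) → (∀ i, b ≠ nv i) →
      G'.c a b = G.c a b) :
    ∀ S ⊆ K,
      mincut G' (if v ∈ K then insert (nv ⟨0, hd⟩) (K.erase v) else K)
        (if v ∈ S then insert (nv ⟨0, hd⟩) (S.erase v) else S)
      = mincut G K S := by
  intro S hS
  have hvn : ∀ i, nv i ≠ v := fun i h => hnv_fresh i (h ▸ hv)
  have hnsv : ∀ i, ns i ∈ G.verts ∧ ns i ≠ v := fun i => by
    have h := (hns (ns i)).2 ⟨i, rfl⟩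
    refine ⟨(G.adj_mem _ _ h).2, fun e => ?_⟩
    rw [e] at h
    exact G.irrefl _ h
  have hnn : ∀ i j, ns i ≠ nv j := fun i j h => hnv_fresh j (h ▸ (hnsv i).1)
  have hold : ∀ a ∈ G.verts.erase v, ∀ b ∈ G.verts.erase v, G'.c a b = G.c a b := by
    intro a ha b hb
    rw [Finset.mem_erase] at ha hb
    exact hc_old a b ha.1 hb.1 (fun i h => hnv_fresh i (h ▸ ha.2))
      (fun i h => hnv_fresh i (h ▸ hb.2))
  have hzero : ∀ a ∈ G.verts, ∀ i, a ≠ ns i → G'.c a (nv i) = 0 := by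
    intro a ha i hai
    have han : ∀ j, a ≠ nv j := fun j h => hnv_fresh j (h ▸ ha)
    apply G'.c_support
    rw [hAdj]
    rintro (⟨h, -, -⟩ | ⟨j, l, -, h⟩ | ⟨j, h⟩)
    · exact hnv_fresh i (G.adj_mem _ _ h).2
    · have : a ∈ ({nv j, nv l} : Set V) := h ▸ (by simp)
      rcases this with h | h
      · exact han _ h
      · exact han _ h
    · have h1 : a ∈ ({ns j, nv j} : Set V) := h ▸ (by simp)
      have h2 : nv i ∈ ({ns j, nv j} : Set V) := h ▸ (by simp)
      rcases h1 with h1 | h1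
      · rcases h2 with h2 | h2
        · exact hnn _ _ h2.symm
        · exact hai (h1.trans (congrArg ns (hnv_inj h2).symm))
      · exact han _ h1
  have hstar : ∀ a ∈ G.verts.erase v, ∑ i, G'.c a (nv i) = G.c a v := by
    intro a ha
    have ha' := Finset.mem_of_mem_erase ha
    by_cases h : ∃ j, ns j = a
    · obtain ⟨j, rfl⟩ := h
      rw [Finset.sum_eq_single j, hc_star]
      · intro i _ hij
        exact hzero _ ha' i fun h => hij (hns_inj h).symm
      · simp
    · rw [G.c_symm, G.c_support v a (fun h' => h ((hns a).1 h'))]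
      exact Finset.sum_eq_zero fun i _ => hzero a ha' i fun e => h ⟨i, e.symm⟩
  have hnvm : ∀ i, nv i ∈ G'.verts := fun i => by rw [hverts]; simp
  have hvG' : v ∉ G'.verts := by
    rw [hverts]; simp [hvn]
  have hnK : ∀ i, nv i ∉ K := fun i h => hnv_fresh i (hK h)
  have hnS : ∀ i, nv i ∉ S := fun i h => hnK i (hS h)
  set K' := (if v ∈ K then insert (nv ⟨0, hd⟩) (K.erase v) else K) with hK'
  set S' := (if v ∈ S then insert (nv ⟨0, hd⟩) (S.erase v) else S) with hS'
  have key : ∀ T : Finset V, T ⊆ G.verts → ∀ a,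
      a ∈ (if v ∈ T then insert (nv ⟨0, hd⟩) (T.erase v) else T) ↔
        (a = nv ⟨0, hd⟩ ∧ v ∈ T) ∨ (a ≠ v ∧ a ∈ T) := by
    intro T hT a
    by_cases h : v ∈ T
    · simp [h]
    · simp only [h, if_false, and_false, false_or]
      exact ⟨fun ha => ⟨fun e => h (e ▸ ha), ha⟩, fun ha => ha.2⟩
  have kK : ∀ a, a ∈ K' ↔ _ := key K hK
  have kS : ∀ a, a ∈ S' ↔ _ := key S (hS.trans hK)
  have hcap : ∀ U U' : Finset V, U' ⊆ G'.verts →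
      (∀ a ∈ G.verts.erase v, (a ∈ U' ↔ a ∈ U)) → (∀ i, nv i ∈ U' ↔ v ∈ U) →
      (U' ∩ K' = S' ↔ U ∩ K = S) := by
    intro U U' hU' h1 h2
    have hvU' : v ∉ U' := fun h => hvG' (hU' h)
    simp only [Finset.ext_iff, Finset.mem_inter, kK, kS]
    constructor
    · intro h a
      by_cases hav : a = v
      · subst hav
        have := h (nv ⟨0, hd⟩)
        simpa [h2, hnK, hnS] using this
      · by_cases haK : a ∈ K
        · have := h a
          have hn : a ≠ nv ⟨0, hd⟩ := fun e => hnK _ (e ▸ haK)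
          rw [h1 a (Finset.mem_erase.2 ⟨hav, hK haK⟩)] at this
          simpa [hav, haK, hn] using this
        · have : a ∉ S := fun h => haK (hS h)
          simp [haK, this]
    · intro h a
      by_cases hn : a = nv ⟨0, hd⟩
      · subst hn
        have := h v
        simpa [h2, hnK, hnS] using this
      · by_cases hav : a = v
        · subst hav
          simp [hn]
        · by_cases haK : a ∈ K
          · have := h a
            rw [h1 a (Finset.mem_erase.2 ⟨hav, hK haK⟩)]
            simpa [hav, haK, hn] using this
          · have : a ∉ S := fun h => haK (hS h)
            simp [haK, this, hn]
  have hcost := cutCost_split G G' v hv d nv hnv_inj hnv_fresh hverts hold hstar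
  have bdd : ∀ (H : WGraph V) (L T : Finset V),
      BddBelow {x | ∃ U : Finset V, U ⊆ H.verts ∧ U ∩ L = T ∧ x = cutCost H U} := by
    intro H L T
    refine ⟨0, ?_⟩
    rintro x ⟨U, -, -, rfl⟩
    exact cutCost_nonneg H U
  have neG : cutCost G S ∈ {x | ∃ U : Finset V, U ⊆ G.verts ∧ U ∩ K = S ∧ x = cutCost G U} :=
    ⟨S, hS.trans hK, Finset.inter_eq_left.2 hS, rfl⟩
  have fwd : ∀ x, x ∈ {x | ∃ U : Finset V, U ⊆ G.verts ∧ U ∩ K = S ∧ x = cutCost G U} →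
      x ∈ {x | ∃ U : Finset V, U ⊆ G'.verts ∧ U ∩ K' = S' ∧ x = cutCost G' U} := by
    rintro x ⟨U, hU, hUK, rfl⟩
    have hnU : ∀ i, nv i ∉ U := fun i h => hnv_fresh i (hU h)
    let U' : Finset V := G'.verts.filter fun a =>
      (a ∈ G.verts ∧ a ∈ U) ∨ (a ∉ G.verts ∧ v ∈ U)
    have hU' : U' ⊆ G'.verts := Finset.filter_subset _ _
    have h1 : ∀ a ∈ G.verts.erase v, (a ∈ U' ↔ a ∈ U) := by
      intro a ha
      have ha' : a ∈ G'.verts := by rw [hverts]; exact Finset.mem_union_left _ ha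
      simp [U', ha', Finset.mem_of_mem_erase ha]
    have h2 : ∀ i, nv i ∈ U' ↔ v ∈ U := by
      intro i
      simp [U', hnvm, hnv_fresh]
    exact ⟨U', hU', (hcap U U' hU' h1 h2).2 hUK, (hcost U U' hU hU' h1 h2).symm⟩
  unfold mincut
  apply le_antisymm
  · exact csInf_le_csInf (bdd _ _ _) ⟨_, neG⟩ fwd
  · refine le_csInf ⟨_, fwd _ neG⟩ ?_
    rintro x ⟨U', hU', hUK, rfl⟩
    by_cases hun : ∀ i j : Fin d, (i : ℕ) + 1 = j → (nv i ∈ U' ↔ nv j ∈ U')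
    · have hall := fin_step hd (fun i => nv i ∈ U') hun
      let U : Finset V := G.verts.filter fun a =>
        (a ≠ v ∧ a ∈ U') ∨ (a = v ∧ nv ⟨0, hd⟩ ∈ U')
      have hU : U ⊆ G.verts := Finset.filter_subset _ _
      have h1 : ∀ a ∈ G.verts.erase v, (a ∈ U' ↔ a ∈ U) := by
        intro a ha
        rw [Finset.mem_erase] at ha
        simp [U, ha]
      have h2 : ∀ i, nv i ∈ U' ↔ v ∈ U := by
        intro i
        rw [hall i]
        simp [U, hv]
      exact csInf_le (bdd _ _ _)
        ⟨U, hU, (hcap U U' hU' h1 h2).1 hUK, hcost U U' hU hU' h1 h2⟩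
    · refine (csInf_le (bdd _ _ _) neG).trans ?_
      have hb := cutCost_le_half G S (hS.trans hK)
      rw [← hC] at hb
      push Not at hun
      obtain ⟨i, j, hij, h⟩ := hun
      have hp := hc_path i j hij
      rcases h with ⟨hi, hj⟩ | ⟨hi, hj⟩
      · have := le_cutCost G' U' _ _ hi (hnvm j) hj
        linarith
      · have := le_cutCost G' U' _ _ hj (hnvm i) hi
        rw [G'.c_symm] at this
        linarith
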